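/- arXiv:1301.6071 — 2 statements merged into one kernel-verified Lean document; each statement's English description precedes it below -/
import Mathlib

section
/- Let d ≥ 5, K > 0, and Γ_n = K n^{−d/2} Σ_{k=1}^{n} k^{1−d/2} φ_{2k/5} for n ≥ 1. Then the sequence {Γ_n} satisfies Conditions B1–B4; in particular: (i) there is a constant L(d) such that Γ_m * Γ_n ≤ L K ((m+n)/(mn))^{d/2} Γ_{m+n} pointwise for all m, n ≥ 1, and the numbers χ_n(s) := L K (n/(s(n−s)))^{d/2} satisfy χ_n(s) = χ_n(n−s) and Σ_{s=1}^{n−1} (s ∧ (n−s)) χ_n(s) ≤ K₁ for all n, for a constant K₁ depending only on d and K; (ii) there is K₂ with Γ_s ≤ K₂ Γ_{2t} for t ≤ s ≤ 2t; (iii) there is a constant L(d) such that for integers m and reals t with m ≤ t and k = 0,1,2: ∫ φ_t(x−y)|y|^{2k} Γ_m(y) dy ≤ L γ^{(k)}(m) φ_{t+m}(x), where γ^{(k)}(m) = ∫ |y|^{2k} Γ_m(y) dy; (iv) Σ_n n γ^{(0)}(n) < ∞, Σ_n γ^{(1)}(n) < ∞, and Σ_n n^{−1} γ^{(2)}(n)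 < ∞. -/
open MeasureTheory Filter Finset
open scoped Classical

noncomputable section

abbrev Ed (d : ℕ) := EuclideanSpace ℝ (Fin d)

/-- The centered Gaussian density `φ_t` on `ℝ^d` with covariance `t · Id`. -/
def gauss (d : ℕ) (t : ℝ) (x : Ed d) : ℝ :=
  (2 * Real.pi * t) ^ (-(d : ℝ) / 2) * Real.exp (-‖x‖ ^ 2 / (2 * t))

/-- Convolution of two functions on `ℝ^d`. -/
def convl (d : ℕ) (f g : Ed d → ℝ) (x : Ed d) : ℝ := ∫ y, f y * g (x - y)

/-- `γ^{(k)}(m) = ∫ |y|^{2k} Γ_m(y) dy`. -/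
def gammaMom {d : ℕ} (Γ : ℕ → Ed d → ℝ) (k m : ℕ) : ℝ := ∫ y, ‖y‖ ^ (2 * k) * Γ m y

/-- A rotationally invariant (radial) function on `ℝ^d`. -/
def Radial {d : ℕ} (f : Ed d → ℝ) : Prop := ∀ x y : Ed d, ‖x‖ = ‖y‖ → f x = f y

/-- A function vanishing at infinity. -/
def VanishAtInfty {d : ℕ} (f : Ed d → ℝ) : Prop := Tendsto f (cocompact (Ed d)) (nhds 0)

/-- Condition B1–B4 on the dominating sequence `Γ`. -/
structure CondB (d : ℕ) (Γ : ℕ → Ed d → ℝ) (χ : ℕ → ℕ → ℝ) (K1 K2 K3 : ℝ) : Prop where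
  pos : ∀ m, 1 ≤ m → ∀ x, 0 < Γ m x
  cont : ∀ m, 1 ≤ m → Continuous (Γ m)
  radial : ∀ m, 1 ≤ m → Radial (Γ m)
  vanish : ∀ m, 1 ≤ m → VanishAtInfty (Γ m)
  integrable : ∀ m, 1 ≤ m → ∀ k, k ≤ 2 → Integrable fun y => ‖y‖ ^ (2 * k) * Γ m y
  chi_pos : ∀ n s, 1 ≤ s → s ≤ n → 0 < χ n s
  chi_symm : ∀ n s, 1 ≤ s → s ≤ n → χ n s = χ n (n - s)
  chi_sum : ∀ n : ℕ, (∑ s ∈ Finset.Ico 1 n, (↑(min s (n - s)) : ℝ) * χ n s) ≤ K1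
  conv_le : ∀ m n, 1 ≤ m → 1 ≤ n → ∀ x, convl d (Γ m) (Γ n) x ≤ χ (m + n) m * Γ (m + n) x
  doubling : ∀ t s : ℕ, 1 ≤ t → t ≤ s → s ≤ 2 * t → ∀ x, Γ s x ≤ K2 * Γ (2 * t) x
  smoothing : ∀ (m : ℕ) (t : ℝ), 1 ≤ m → (m : ℝ) ≤ t → ∀ k, k ≤ 2 → ∀ x,
    (∫ y, gauss d t (x - y) * (‖y‖ ^ (2 * k) * Γ m y)) ≤
      K3 * gammaMom Γ k m * gauss d (t + (m : ℝ)) x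
  sum0 : Summable fun n : ℕ => (n : ℝ) * gammaMom Γ 0 n
  sum1 : Summable fun n : ℕ => gammaMom Γ 1 n
  sum2 : Summable fun n : ℕ => gammaMom Γ 2 n / (n : ℝ)

/-- `b_k = ∫ B_k`. -/
def bInt {d : ℕ} (B : ℕ → Ed d → ℝ) (k : ℕ) : ℝ := ∫ y, B k y

/-- The scalar `b̄_m` with `∫ x xᵀ B_m(x) dx = b̄_m I_d`. -/
def bbar {d : ℕ} (B : ℕ → Ed d → ℝ) (m : ℕ) : ℝ := (∫ y, ‖y‖ ^ 2 * B m y) / d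

/-- Regularity of the sequence `B`, dominated by `Γ`. -/
structure BSeq (d : ℕ) (B Γ : ℕ → Ed d → ℝ) : Prop where
  cont : ∀ m, 1 ≤ m → Continuous (B m)
  radial : ∀ m, 1 ≤ m → Radial (B m)
  vanish : ∀ m, 1 ≤ m → VanishAtInfty (B m)
  integrable : ∀ m, 1 ≤ m → Integrable (B m)
  integrable2 : ∀ m, 1 ≤ m → Integrable fun y => ‖y‖ ^ 2 * B m y
  dom : ∀ m, 1 ≤ m → ∀ x, |B m x| ≤ Γ m x

/-- The recursion for the norming sequence `c`. -/
def cSeq {d : ℕ} (B : ℕ → Ed d → ℝ) (lam : ℝ) (c : ℕ → ℝ) : Prop :=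
  c 0 = 1 ∧ ∀ n, 1 ≤ n →
    c n = c (n - 1) + lam * ∑ k ∈ Finset.Icc 1 n, c k * bInt B k * c (n - k)

/-- The basic convolution recursion for `C` (with `C_0 = δ_0`). -/
def CSeq (d : ℕ) (B : ℕ → Ed d → ℝ) (lam : ℝ) (c : ℕ → ℝ) (C : ℕ → Ed d → ℝ) : Prop :=
  (∀ x, C 1 x = gauss d 1 x + lam * (c 1 * B 1 x)) ∧
  ∀ n, 2 ≤ n → ∀ x, C n x = convl d (C (n - 1)) (gauss d 1) x +
    lam * ((∑ k ∈ Finset.Icc 1 (n - 1), c k * convl d (B k) (C (n - k)) x) + c n * B n x)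

/-- The drift parameter `δ`. -/
def deltaParam {d : ℕ} (B : ℕ → Ed d → ℝ) (lam μ : ℝ) (a : ℕ → ℝ) : ℝ :=
  (μ⁻¹ + lam * ∑' m : ℕ, a (m + 1) * bbar B (m + 1)) /
    (μ⁻¹ + lam * ∑' m : ℕ, ((m : ℝ) + 1) * a (m + 1) * bInt B (m + 1))

def zeta1 {d : ℕ} (Γ : ℕ → Ed d → ℝ) (n : ℕ) : ℝ :=
  1 + ∑ i ∈ Finset.range 3, ∑ m ∈ Finset.Icc 1 n, (m : ℝ) ^ (2 - i) * gammaMom Γ i m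

def zeta2 {d : ℕ} (Γ : ℕ → Ed d → ℝ) (n : ℕ) : ℝ :=
  ∑' m : ℕ, (gammaMom Γ 1 (n + m) + (↑(n + m) : ℝ) * gammaMom Γ 0 (n + m))

def zetaBar {d : ℕ} (Γ : ℕ → Ed d → ℝ) (n : ℕ) : ℝ :=
  (∑ j ∈ Finset.Icc 1 n, zeta1 Γ j) / (n : ℝ) ^ 2 + (∑ j ∈ Finset.Icc 1 n, zeta2 Γ j) / (n : ℝ)

/-- `ψ_n = φ_{nδ(1+ε)}`. -/
def psiFun (d : ℕ) (δv ε : ℝ) (n : ℕ) : Ed d → ℝ := gauss d ((n : ℝ) * δv * (1 + ε))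

/-- `f_n = Σ_{s=1}^{[n/2]} s (ψ_s * Γ_{n-s}) + ζ̄(n) ψ_n`. -/
def fFun (d : ℕ) (Γ : ℕ → Ed d → ℝ) (δv ε : ℝ) (n : ℕ) (x : Ed d) : ℝ :=
  (∑ s ∈ Finset.Icc 1 (n / 2), (s : ℝ) * convl d (psiFun d δv ε s) (Γ (n - s)) x) +
    zetaBar Γ n * psiFun d δv ε n x

/-- `κ(n) = Σ_{s=1}^{[n/2]} ψ_s * Γ_{n-s} + (ζ̄(n)/n) ψ_n`. -/
def kapFun (d : ℕ) (Γ : ℕ → Ed d → ℝ) (δv ε : ℝ) (n : ℕ) (x : Ed d) : ℝ :=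
  (∑ s ∈ Finset.Icc 1 (n / 2), convl d (psiFun d δv ε s) (Γ (n - s)) x) +
    zetaBar Γ n / n * psiFun d δv ε n x

/-- `Δ(k,j)`, with the convention `φ_0 = δ_0` (the `m = k` term is `B_m` itself). -/
def DeltaFun (d : ℕ) (B : ℕ → Ed d → ℝ) (lam μ δv : ℝ) (a : ℕ → ℝ) (k j : ℕ) (x : Ed d) : ℝ :=
  a j * gauss d ((k : ℝ) * δv) x - μ⁻¹ * a (j - 1) * gauss d (((k : ℝ) - 1) * δv + 1) x -
    lam * ∑ m ∈ Finset.Icc 1 j, a m * a (j - m) *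
      (if m = k then B m x else convl d (B m) (gauss d (((k : ℝ) - (m : ℝ)) * δv)) x)

/-! Weakly self-avoiding walk. -/

/-- `I_ρ`, the indicator of the ball of radius `ρ`. -/
def indBall (d : ℕ) (ρ : ℝ) (x : Ed d) : ℝ := if ‖x‖ ≤ ρ then 1 else 0

/-- `K_{λ,ρ}[a,b]`. -/
def Ksaw (d : ℕ) (lam ρ : ℝ) (a b : ℕ) (y : ℕ → Ed d) : ℝ :=
  ∏ p ∈ (Finset.Icc a b ×ˢ Finset.Icc a b).filter fun p => p.1 < p.2,
    (1 - lam * indBall d ρ (y p.2 - y p.1))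

/-- `Φ[a,b]`. -/
def PhiProd (d : ℕ) (a b : ℕ) (y : ℕ → Ed d) : ℝ :=
  ∏ i ∈ Finset.Icc (a + 1) b, gauss d 1 (y i - y (i - 1))

/-- Extend a finite vector `z : Fin L → ℝ^d` to indices `1,…,L` in `ℕ`. -/
def extPath (d L : ℕ) (z : Fin L → Ed d) (i : ℕ) : Ed d :=
  if h : 1 ≤ i ∧ i ≤ L then z ⟨i - 1, by omega⟩ else 0

/-- The path `0, x_1, …, x_{n-1}, x`. -/
def sawPath (d n : ℕ) (x : Ed d) (z : ℕ → Ed d) (j : ℕ) : Ed d :=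
  if j = 0 then 0 else if j = n then x else z j

/-- The connectivity function `C_n^{SAW}`. -/
def Csaw (d : ℕ) (lam ρ : ℝ) (n : ℕ) (x : Ed d) : ℝ :=
  ∫ z : Fin (n - 1) → Ed d,
    Ksaw d lam ρ 0 n (sawPath d n x (extPath d (n - 1) z)) *
      PhiProd d 0 n (sawPath d n x (extPath d (n - 1) z))

/-- `c_n^{SAW} = ∫ C_n^{SAW}`. -/
def csawInt (d : ℕ) (lam ρ : ℝ) (n : ℕ) : ℝ := ∫ x, Csaw d lam ρ n x

/-- Connected graphs on `[a,b]` (in the sense of the lace expansion). -/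
def IsConnGraph (a b : ℕ) (G : Finset (ℕ × ℕ)) : Prop :=
  (∀ p ∈ G, a ≤ p.1 ∧ p.1 < p.2 ∧ p.2 ≤ b) ∧
    (∃ p ∈ G, p.1 = a ∨ p.2 = a) ∧ (∃ p ∈ G, p.1 = b ∨ p.2 = b) ∧
    ∀ c, a < c → c < b → ∃ p ∈ G, p.1 < c ∧ c < p.2

/-- `J[a,b]`, the sum over connected graphs. -/
def Jsaw (d : ℕ) (lam ρ : ℝ) (a b : ℕ) (y : ℕ → Ed d) : ℝ :=
  ∑ G ∈ ((Finset.Icc a b ×ˢ Finset.Icc a b).powerset).filter (IsConnGraph a b),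
    ∏ p ∈ G, -(lam * indBall d ρ (y p.2 - y p.1))

/-- The lace functions `Π_n`. -/
def Pisaw (d : ℕ) (lam ρ : ℝ) (n : ℕ) (x : Ed d) : ℝ :=
  ∫ z : Fin (n - 1) → Ed d,
    Jsaw d lam ρ 0 n (sawPath d n x (extPath d (n - 1) z)) *
      PhiProd d 0 n (sawPath d n x (extPath d (n - 1) z))

/-- The error rates `r_n`. -/
def rseq (d n : ℕ) : ℝ :=
  if d = 5 then (n : ℝ) ^ (-(1 : ℝ) / 2)
  else if d = 6 then Real.log n / n
  else (n : ℝ)⁻¹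

/-- `Γ_n = K n^{-d/2} Σ_{k=1}^n k^{1-d/2} φ_{2k/5}`. -/
def GammaSAW (d : ℕ) (K : ℝ) (n : ℕ) (x : Ed d) : ℝ :=
  K * (n : ℝ) ^ (-(d : ℝ) / 2) *
    ∑ k ∈ Finset.Icc 1 n, (k : ℝ) ^ (1 - (d : ℝ) / 2) * gauss d (2 * k / 5) x

/-- `χ_n(s) = LK (n/(s(n-s)))^{d/2}`. -/
def chiSAW (d : ℕ) (LK : ℝ) (n s : ℕ) : ℝ :=
  LK * ((n : ℝ) / ((s : ℝ) * (↑(n - s) : ℝ))) ^ ((d : ℝ) / 2)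

/-! Laces. -/

/-- `β(j)`: index of the bond of the basic `N`-lace containing the vertex `j`. -/
def betaIdx (N j : ℕ) : ℕ :=
  if j = 0 then 1 else if j = 2 * N - 1 then N else if j % 2 = 0 then j / 2 else (j + 3) / 2

/-- `Φ^{(ν)}_{N,m,t}(x₁,…,x_{N-1})` (with `x 0 = 0` as convention on the argument). -/
def PhiLace (d N : ℕ) (ν : ℝ) (m : Fin (2 * N - 1) → ℕ) (t : Fin (2 * N - 1) → ℝ)
    (x : ℕ → Ed d) : ℝ :=
  ∏ i : Fin (2 * N - 1),
    gauss d (ν * m i + t i) (x (betaIdx N ((i : ℕ) + 1) - 1) - x (betaIdx N (i : ℕ) - 1))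

/-- `L^{(N)}_r[0,n]`: interdistance vectors summing to `n`, bounded below by `r`. -/
def laceFinset (len n : ℕ) (r : Fin len → ℕ) : Finset (Fin len → ℕ) :=
  (Fintype.piFinset fun _ => Finset.range (n + 1)).filter fun m =>
    (∑ i, m i) = n ∧ ∀ i, r i ≤ m i

/-- Extend a vector `Fin len → ℕ` to indices `1,…,len`. -/
def extVec (len : ℕ) (m : Fin len → ℕ) (i : ℕ) : ℕ :=
  if h : 1 ≤ i ∧ i ≤ len then m ⟨i - 1, by omega⟩ else 0

/-- The vertices of a lace diagram, collapsing steps with `m_i = 0` (`G_0 = δ_0`). -/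
def laceVertex (d N : ℕ) (m : ℕ → ℕ) (x : Ed d) (z : ℕ → Ed d) : ℕ → Ed d
  | 0 => 0
  | i + 1 =>
    if i + 1 = 2 * N - 1 then x
    else if m (i + 1) = 0 then laceVertex d N m x z i
    else z (i + 1)

/-- Lower endpoint `i̲` of the `i`-th bond of the basic `N`-lace. -/
def bLow (i : ℕ) : ℕ := if i = 1 then 0 else 2 * i - 3

/-- Upper endpoint `ī` of the `i`-th bond of the basic `N`-lace. -/
def bHigh (N i : ℕ) : ℕ := if i = N then 2 * N - 1 else 2 * i

/-- `Ξ_ℓ(G,ρ)(x)`; coordinates with `m_i = 0` are collapsed (the `δ_0` convention),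
and the corresponding unused integration variables are normalized away by a
standard Gaussian factor. -/
def XiLace (d N : ℕ) (G : ℕ → Ed d → ℝ) (ρ : ℝ) (m : Fin (2 * N - 1) → ℕ) (x : Ed d) : ℝ :=
  ∫ z : Fin (2 * N - 2) → Ed d,
    (∏ i ∈ Finset.Icc 1 (2 * N - 1),
      if extVec (2 * N - 1) m i = 0 then gauss d 1 (extPath d (2 * N - 2) z i)
      else
        G (extVec (2 * N - 1) m i)
          (laceVertex d N (extVec (2 * N - 1) m) x (extPath d (2 * N - 2) z) i -
            laceVertex d N (extVec (2 * N - 1) m) x (extPath d (2 * N - 2) z) (i - 1))) *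
    ∏ i ∈ Finset.Icc 1 N,
      indBall d ρ
        (laceVertex d N (extVec (2 * N - 1) m) x (extPath d (2 * N - 2) z) (bHigh N i) -
          laceVertex d N (extVec (2 * N - 1) m) x (extPath d (2 * N - 2) z) (bLow i))

/-- The natural restriction vector `r⁰` for `N`-laces (`0`-indexed). -/
def r0vec (N : ℕ) (j : Fin (2 * N - 1)) : ℕ :=
  if (j : ℕ) % 2 = 1 ∨ (j : ℕ) = 0 ∨ (j : ℕ) = 2 * N - 2 then 1 else 0

/-- `ξ_n^{(N)}(G,ρ) = Σ_{ℓ ∈ L^{(N)}[0,n]} Ξ_ℓ(G,ρ)`. -/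
def xiLace (d N : ℕ) (G : ℕ → Ed d → ℝ) (ρ : ℝ) (n : ℕ) (x : Ed d) : ℝ :=
  ∑ m ∈ laceFinset (2 * N - 1) n (r0vec N), XiLace d N G ρ m x

/-- `Γ_n = n^{-a} φ_{n/2}`. -/
def GammaPoly (d : ℕ) (a : ℝ) (n : ℕ) (x : Ed d) : ℝ := (n : ℝ) ^ (-a) * gauss d ((n : ℝ) / 2) x

section GaussianFacts

variable {d : ℕ}

theorem gauss_pos {t : ℝ} (ht : 0 < t) (x : Ed d) : 0 < gauss d t x := by
  unfold gauss; positivity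

theorem continuous_gauss (t : ℝ) : Continuous (gauss d t) := by
  unfold gauss; fun_prop

theorem integral_gauss {t : ℝ} (ht : 0 < t) : ∫ y, gauss d t y = 1 := by
  have h := GaussianFourier.integral_rexp_neg_mul_sq_norm (V := Ed d)
    (b := 1 / (2 * t)) (by positivity)
  have hE : ∀ y : Ed d, -‖y‖ ^ 2 / (2 * t) = -(1 / (2 * t)) * ‖y‖ ^ 2 := fun y => by ring
  have hb : Real.pi / (1 / (2 * t)) = 2 * Real.pi * t := by field_simp
  simp only [gauss, hE, integral_const_mul, h, hb, finrank_euclideanSpace, Fintype.card_fin]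
  rw [← Real.rpow_add (by positivity)]
  ring_nf
  exact Real.rpow_zero _

theorem integrable_gauss {t : ℝ} (ht : 0 < t) : Integrable (gauss d t) :=
  integrable_of_integral_eq_one (integral_gauss ht)

/-- Completing the square in a product of two Gaussian densities. -/
theorem gauss_mul_gauss_sub {s t : ℝ} (hs : 0 < s) (ht : 0 < t) (x y : Ed d) :
    gauss d s y * gauss d t (x - y) =
      gauss d (s + t) x * gauss d (s * t / (s + t)) (y - (s / (s + t)) • x) := by
  have hst : 0 < s + t := by positivity
  unfold gauss
  rw [mul_mul_mul_comm, mul_mul_mul_comm (b := Real.exp _), ← Real.mul_rpow (by positivity)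
    (by positivity), ← Real.mul_rpow (by positivity) (by positivity), ← Real.exp_add,
    ← Real.exp_add]
  congr 2
  · field_simp
  · rw [norm_sub_sq_real, norm_sub_sq_real, inner_smul_right, norm_smul, Real.norm_eq_abs,
      mul_pow, sq_abs, real_inner_comm x y]
    field_simp
    ring

theorem convl_gauss {s t : ℝ} (hs : 0 < s) (ht : 0 < t) (x : Ed d) :
    convl d (gauss d s) (gauss d t) x = gauss d (s + t) x := by
  simp only [convl, gauss_mul_gauss_sub hs ht, integral_const_mul]
  rw [integral_sub_right_eq_self (fun y => gauss d (s * t / (s + t)) y),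
    integral_gauss (by positivity), mul_one]

theorem integrable_gauss_mul_gauss_sub {s t : ℝ} (hs : 0 < s) (ht : 0 < t) (x : Ed d) :
    Integrable fun y => gauss d s y * gauss d t (x - y) := by
  simp only [gauss_mul_gauss_sub hs ht]
  exact ((integrable_gauss (by positivity)).comp_sub_right _).const_mul _

theorem tendsto_gauss_cocompact {t : ℝ} (ht : 0 < t) : VanishAtInfty (gauss d t) := by
  have h : Tendsto (fun x : Ed d => -‖x‖ ^ 2 / (2 * t)) (cocompact (Ed d)) atBot := by
    have h1 : Tendsto (fun x : Ed d => ‖x‖ ^ 2 / (2 * t)) (cocompact (Ed d)) atTop :=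
      (((tendsto_pow_atTop (two_ne_zero)).comp (tendsto_norm_cocompact_atTop (E := Ed d))
        ).atTop_div_const (by positivity))
    simpa only [neg_div, Function.comp_def] using tendsto_neg_atTop_atBot.comp h1
  have := (Real.tendsto_exp_atBot.comp h).const_mul ((2 * Real.pi * t) ^ (-(d : ℝ) / 2))
  rw [mul_zero] at this
  exact this

theorem gauss_le_of_le {s t : ℝ} (hs : 0 < s) (hst : s ≤ t) (hts : t ≤ 2 * s) (x : Ed d) :
    gauss d s x ≤ 2 ^ ((d : ℝ) / 2) * gauss d t x := by
  have ht : 0 < t := hs.trans_le hst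
  unfold gauss
  rw [← mul_assoc]
  refine mul_le_mul ?_ (Real.exp_le_exp.2 ?_) (Real.exp_pos _).le (by positivity)
  · have h2 : (2 : ℝ) ^ ((d : ℝ) / 2) = (1 / 2) ^ (-(d : ℝ) / 2) := by
      rw [one_div, Real.inv_rpow (by norm_num), neg_div, Real.rpow_neg (by norm_num), inv_inv]
    rw [h2, ← Real.mul_rpow (by positivity) (by positivity)]
    refine Real.rpow_le_rpow_of_nonpos (by positivity) ?_ ?_
    · nlinarith [Real.pi_pos]
    · have : (0 : ℝ) ≤ d := by positivity
      linarith
  · rw [neg_div, neg_div, neg_le_neg_iff]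
    gcongr

/-- A polynomial weight is absorbed by widening the Gaussian. -/
theorem norm_pow_mul_gauss_le (k : ℕ) {s : ℝ} (hs : 0 < s) (y : Ed d) :
    ‖y‖ ^ (2 * k) * gauss d (2 * s / 5) y ≤
      (2 / 5) ^ (-(d : ℝ) / 2) * ((4 / 3) ^ k * k.factorial) * s ^ k * gauss d s y := by
  have hu : 0 ≤ 3 / 4 * (‖y‖ ^ 2 / s) := by positivity
  have h := Real.pow_div_factorial_le_exp _ hu k
  rw [div_le_iff₀ (by positivity)] at h
  have hy : ‖y‖ ^ (2 * k) = (4 / 3) ^ k * s ^ k * (3 / 4 * (‖y‖ ^ 2 / s)) ^ k := by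
    rw [← mul_pow, ← mul_pow, pow_mul]
    congr 1
    field_simp
  have hc : (2 * Real.pi * (2 * s / 5)) ^ (-(d : ℝ) / 2) =
      (2 / 5) ^ (-(d : ℝ) / 2) * (2 * Real.pi * s) ^ (-(d : ℝ) / 2) := by
    rw [← Real.mul_rpow (by positivity) (by positivity)]
    congr 1
    ring
  have he : Real.exp (-‖y‖ ^ 2 / (2 * s)) =
      Real.exp (3 / 4 * (‖y‖ ^ 2 / s)) * Real.exp (-‖y‖ ^ 2 / (2 * (2 * s / 5))) := by
    rw [← Real.exp_add]
    congr 1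
    field_simp
    ring
  unfold gauss
  rw [hy, hc, he]
  calc _ = ((4 / 3) ^ k * s ^ k * ((2 / 5) ^ (-(d : ℝ) / 2) *
        (2 * Real.pi * s) ^ (-(d : ℝ) / 2)) * Real.exp (-‖y‖ ^ 2 / (2 * (2 * s / 5)))) *
          (3 / 4 * (‖y‖ ^ 2 / s)) ^ k := by ring
    _ ≤ _ := mul_le_mul_of_nonneg_left h (by positivity)
    _ = _ := by ring

theorem integrable_norm_pow_mul_gauss (k : ℕ) {s : ℝ} (hs : 0 < s) :
    Integrable fun y => ‖y‖ ^ (2 * k) * gauss d s y := by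
  have hs' : 0 < 5 * s / 2 := by positivity
  have he : 2 * (5 * s / 2) / 5 = s := by ring
  refine ((integrable_gauss (d := d) hs').const_mul ((2 / 5) ^ (-(d : ℝ) / 2) *
    ((4 / 3) ^ k * k.factorial) * (5 * s / 2) ^ k)).mono' ?_ (Eventually.of_forall fun y => ?_)
  · have := continuous_gauss (d := d) s
    exact Continuous.aestronglyMeasurable (by fun_prop)
  · have h := norm_pow_mul_gauss_le k hs' y
    rw [he] at h
    rwa [Real.norm_of_nonneg (mul_nonneg (by positivity) (gauss_pos hs y).le)]

/-- The moments of the standard Gaussian. -/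
def gaussMoment (d k : ℕ) : ℝ := ∫ y : Ed d, ‖y‖ ^ (2 * k) * gauss d 1 y

theorem gaussMoment_pos (hd : d ≠ 0) (k : ℕ) : 0 < gaussMoment d k := by
  have : NeZero d := ⟨hd⟩
  have hc := continuous_gauss (d := d) 1
  refine integral_pos_of_integrable_nonneg_nonzero
    (x := EuclideanSpace.single (0 : Fin d) (1 : ℝ)) (by fun_prop)
    (integrable_norm_pow_mul_gauss k one_pos)
    (fun y => mul_nonneg (by positivity) (gauss_pos one_pos y).le) ?_
  simpa using (gauss_pos one_pos _).ne'

theorem integral_norm_pow_mul_gauss (k : ℕ) {s : ℝ} (hs : 0 < s) :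
    ∫ y : Ed d, ‖y‖ ^ (2 * k) * gauss d s y = s ^ k * gaussMoment d k := by
  have h := Measure.integral_comp_smul (volume : Measure (Ed d))
    (fun y => ‖y‖ ^ (2 * k) * gauss d s y) (Real.sqrt s)
  have hR : Real.sqrt s ^ d = s ^ ((d : ℝ) / 2) := by
    rw [Real.sqrt_eq_rpow, ← Real.rpow_natCast, ← Real.rpow_mul hs.le]
    ring_nf
  have hf : ∀ z : Ed d, ‖Real.sqrt s • z‖ ^ (2 * k) * gauss d s (Real.sqrt s • z) =
      (s ^ ((d : ℝ) / 2))⁻¹ * s ^ k * (‖z‖ ^ (2 * k) * gauss d 1 z) := fun z => by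
    have hn : ‖Real.sqrt s • z‖ ^ 2 = s * ‖z‖ ^ 2 := by
      rw [norm_smul, mul_pow, Real.norm_of_nonneg (Real.sqrt_nonneg _), Real.sq_sqrt hs.le]
    have he : -(s * ‖z‖ ^ 2) / (2 * s) = -‖z‖ ^ 2 / (2 * 1) := by field_simp
    unfold gauss
    rw [pow_mul, hn, he, Real.mul_rpow (by positivity) hs.le, neg_div, Real.rpow_neg hs.le,
      mul_pow, ← pow_mul, mul_one]
    ring_nf
  simp only [hf, integral_const_mul, hR, finrank_euclideanSpace, Fintype.card_fin,
    smul_eq_mul] at h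
  have hp : 0 < s ^ ((d : ℝ) / 2) := by positivity
  rw [abs_of_pos (by positivity), mul_assoc] at h
  exact (mul_left_cancel₀ (inv_ne_zero hp.ne') h).symm

end GaussianFacts

section PowerSums

theorem sum_Icc_rpow_le_tsum {p : ℝ} (hp : p < -1) (n : ℕ) :
    ∑ k ∈ Finset.Icc 1 n, (k : ℝ) ^ p ≤ ∑' k : ℕ, (k : ℝ) ^ p :=
  (Real.summable_nat_rpow.2 hp).sum_le_tsum _ fun _ _ => by positivity

theorem tsum_rpow_pos {p : ℝ} (hp : p < -1) : 0 < ∑' k : ℕ, (k : ℝ) ^ p := by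
  refine lt_of_lt_of_le ?_ (sum_Icc_rpow_le_tsum hp 1)
  simp

theorem div_mul_rpow_le {q a b : ℝ} (hq : 0 ≤ q) (ha : 0 < a) (hb : 0 < b) :
    ((a + b) / (a * b)) ^ q ≤ 2 ^ q * (min a b) ^ (-q) := by
  have hm : 0 < min a b := lt_min ha hb
  rw [Real.rpow_neg hm.le, ← Real.inv_rpow hm.le, ← Real.mul_rpow (by norm_num) (by positivity)]
  refine Real.rpow_le_rpow (by positivity) ?_ hq
  have e : (a + b) / (a * b) = a⁻¹ + b⁻¹ := by field_simp; ring
  rw [e, two_mul]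
  exact add_le_add (inv_anti₀ hm (min_le_left _ _)) (inv_anti₀ hm (min_le_right _ _))

theorem min_rpow_le_add {p a b : ℝ} (ha : 0 < a) (hb : 0 < b) :
    (min a b) ^ p ≤ a ^ p + b ^ p := by
  rcases min_choice a b with h | h <;> rw [h]
  · exact le_add_of_nonneg_right (by positivity)
  · exact le_add_of_nonneg_left (by positivity)

theorem rpow_mul_rpow_le {p a b : ℝ} (hp : p ≤ 0) (ha : 0 < a) (hb : 0 < b) :
    a ^ p * b ^ p ≤ 2 ^ (-p) * (a + b) ^ p * (a ^ p + b ^ p) := by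
  have h := (div_mul_rpow_le (q := -p) (by linarith) ha hb)
  rw [neg_neg, Real.rpow_neg (by positivity), ← Real.inv_rpow (by positivity), inv_div,
    Real.div_rpow (by positivity) (by positivity), Real.mul_rpow ha.le hb.le,
    div_le_iff₀ (by positivity)] at h
  calc _ ≤ _ := h
    _ ≤ 2 ^ (-p) * (a ^ p + b ^ p) * (a + b) ^ p := by
      gcongr
      exact min_rpow_le_add ha hb
    _ = _ := by ring

theorem sum_Icc_shift_le {f : ℕ → ℝ} (hf : ∀ l, 0 ≤ f l) {m n j : ℕ} (hj : j ≤ m) :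
    ∑ k ∈ Finset.Icc 1 n, f (j + k) ≤ ∑ l ∈ Finset.Icc 1 (m + n), f l := by
  rw [← Finset.sum_image (f := f) (g := fun k => j + k) fun a _ b _ h => by simpa using h]
  refine Finset.sum_le_sum_of_subset_of_nonneg (fun l hl => ?_) fun l _ _ => hf l
  simp only [Finset.mem_image, Finset.mem_Icc] at hl ⊢
  omega

/-- Double sums of `(jk)^p f(j+k)` are controlled by a single sum of `l^p f(l)`. -/
theorem sum_sum_rpow_mul_le {p : ℝ} (hp : p < -1) {f : ℕ → ℝ} (hf : ∀ l, 0 ≤ f l) (m n : ℕ) :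
    ∑ j ∈ Finset.Icc 1 m, ∑ k ∈ Finset.Icc 1 n, (j : ℝ) ^ p * (k : ℝ) ^ p * f (j + k) ≤
      2 ^ (-p) * (2 * ∑' k : ℕ, (k : ℝ) ^ p) *
        ∑ l ∈ Finset.Icc 1 (m + n), (l : ℝ) ^ p * f l := by
  set g : ℕ → ℝ := fun l => (l : ℝ) ^ p * f l with hg
  have hg0 : ∀ l, 0 ≤ g l := fun l => mul_nonneg (by positivity) (hf l)
  set Z : ℝ := ∑' k : ℕ, (k : ℝ) ^ p
  set S : ℝ := ∑ l ∈ Finset.Icc 1 (m + n), g l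
  have hS : 0 ≤ S := Finset.sum_nonneg fun l _ => hg0 l
  have h1 : ∑ j ∈ Finset.Icc 1 m, ∑ k ∈ Finset.Icc 1 n, (j : ℝ) ^ p * g (j + k) ≤ Z * S := by
    calc _ ≤ ∑ j ∈ Finset.Icc 1 m, (j : ℝ) ^ p * S := by
          refine Finset.sum_le_sum fun j hj => ?_
          rw [← Finset.mul_sum]
          exact mul_le_mul_of_nonneg_left (sum_Icc_shift_le hg0 (Finset.mem_Icc.1 hj).2)
            (by positivity)
      _ = (∑ j ∈ Finset.Icc 1 m, (j : ℝ) ^ p) * S := by rw [Finset.sum_mul]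
      _ ≤ _ := mul_le_mul_of_nonneg_right (sum_Icc_rpow_le_tsum hp m) hS
  have h2 : ∑ j ∈ Finset.Icc 1 m, ∑ k ∈ Finset.Icc 1 n, (k : ℝ) ^ p * g (j + k) ≤ Z * S := by
    rw [Finset.sum_comm]
    calc _ ≤ ∑ k ∈ Finset.Icc 1 n, (k : ℝ) ^ p * S := by
          refine Finset.sum_le_sum fun k hk => ?_
          rw [← Finset.mul_sum]
          refine mul_le_mul_of_nonneg_left ?_ (by positivity)
          have := sum_Icc_shift_le hg0 (m := n) (n := m) (Finset.mem_Icc.1 hk).2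
          rw [add_comm n m] at this
          simpa only [add_comm k] using this
      _ = (∑ k ∈ Finset.Icc 1 n, (k : ℝ) ^ p) * S := by rw [Finset.sum_mul]
      _ ≤ _ := mul_le_mul_of_nonneg_right (sum_Icc_rpow_le_tsum hp n) hS
  calc _ ≤ ∑ j ∈ Finset.Icc 1 m, ∑ k ∈ Finset.Icc 1 n,
        2 ^ (-p) * ((j : ℝ) ^ p * g (j + k) + (k : ℝ) ^ p * g (j + k)) := by
        refine Finset.sum_le_sum fun j hj => Finset.sum_le_sum fun k hk => ?_
        have hj' : (0 : ℝ) < j := by exact_mod_cast (Finset.mem_Icc.1 hj).1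
        have hk' : (0 : ℝ) < k := by exact_mod_cast (Finset.mem_Icc.1 hk).1
        have := mul_le_mul_of_nonneg_right
          (rpow_mul_rpow_le (p := p) (by linarith) hj' hk') (hf (j + k))
        refine this.trans (le_of_eq ?_)
        simp only [hg]
        push_cast
        ring
    _ = 2 ^ (-p) * (∑ j ∈ Finset.Icc 1 m, ∑ k ∈ Finset.Icc 1 n, (j : ℝ) ^ p * g (j + k) +
        ∑ j ∈ Finset.Icc 1 m, ∑ k ∈ Finset.Icc 1 n, (k : ℝ) ^ p * g (j + k)) := by
        simp only [← Finset.mul_sum, Finset.sum_add_distrib]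
    _ ≤ 2 ^ (-p) * (Z * S + Z * S) := by gcongr
    _ = _ := by ring

end PowerSums

section GammaSAWFacts

variable {d : ℕ} {K : ℝ}

theorem one_sub_half_lt (hd : 5 ≤ d) : 1 - (d : ℝ) / 2 < -1 := by
  have : (5 : ℝ) ≤ d := by exact_mod_cast hd
  linarith

theorem two_mul_div_five_pos {n k : ℕ} (hk : k ∈ Finset.Icc 1 n) : (0 : ℝ) < 2 * k / 5 := by
  have : (0 : ℝ) < k := by exact_mod_cast (Finset.mem_Icc.1 hk).1
  positivity

theorem GammaSAW_pos (hK : 0 < K) {m : ℕ} (hm : 1 ≤ m) (x : Ed d) : 0 < GammaSAW d K m x := by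
  have hm' : (0 : ℝ) < m := by exact_mod_cast hm
  refine mul_pos (by positivity) (Finset.sum_pos (fun k hk => ?_) ⟨1, by simpa using hm⟩)
  have hk' : (0 : ℝ) < k := by exact_mod_cast (Finset.mem_Icc.1 hk).1
  exact mul_pos (by positivity) (gauss_pos (two_mul_div_five_pos hk) x)

theorem continuous_GammaSAW (m : ℕ) : Continuous (GammaSAW d K m) := by
  unfold GammaSAW
  exact continuous_const.mul
    (continuous_finsetSum _ fun k _ => continuous_const.mul (continuous_gauss _))

theorem radial_GammaSAW (m : ℕ) : Radial (GammaSAW d K m) := fun x y h => by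
  simp only [GammaSAW, gauss, h]

theorem vanishAtInfty_GammaSAW (m : ℕ) : VanishAtInfty (GammaSAW d K m) := by
  have h : Tendsto (fun x : Ed d => K * (m : ℝ) ^ (-(d : ℝ) / 2) *
      ∑ k ∈ Finset.Icc 1 m, (k : ℝ) ^ (1 - (d : ℝ) / 2) * gauss d (2 * k / 5) x)
      (cocompact (Ed d)) (nhds (K * (m : ℝ) ^ (-(d : ℝ) / 2) *
        ∑ k ∈ Finset.Icc 1 m, (k : ℝ) ^ (1 - (d : ℝ) / 2) * 0)) :=
    (tendsto_finsetSum _ fun k hk =>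
      (tendsto_gauss_cocompact (two_mul_div_five_pos hk)).const_mul _).const_mul _
  simp only [mul_zero, Finset.sum_const_zero] at h
  exact h

theorem norm_pow_mul_GammaSAW (k m : ℕ) (y : Ed d) :
    ‖y‖ ^ (2 * k) * GammaSAW d K m y = K * (m : ℝ) ^ (-(d : ℝ) / 2) *
      ∑ j ∈ Finset.Icc 1 m, (j : ℝ) ^ (1 - (d : ℝ) / 2) *
        (‖y‖ ^ (2 * k) * gauss d (2 * j / 5) y) := by
  rw [GammaSAW, mul_left_comm, Finset.mul_sum]
  simp only [mul_left_comm]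

theorem integrable_norm_pow_mul_GammaSAW (k m : ℕ) :
    Integrable fun y => ‖y‖ ^ (2 * k) * GammaSAW d K m y := by
  simp only [norm_pow_mul_GammaSAW]
  exact (integrable_finsetSum _ fun j hj =>
    (integrable_norm_pow_mul_gauss k (two_mul_div_five_pos hj)).const_mul _).const_mul _

theorem gammaMom_GammaSAW (k m : ℕ) :
    gammaMom (GammaSAW d K) k m = K * (m : ℝ) ^ (-(d : ℝ) / 2) *
      ((2 / 5) ^ k * gaussMoment d k *
        ∑ j ∈ Finset.Icc 1 m, (j : ℝ) ^ (1 - (d : ℝ) / 2) * (j : ℝ) ^ k) := by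
  simp only [gammaMom, norm_pow_mul_GammaSAW, integral_const_mul]
  rw [integral_finsetSum _ fun j hj =>
    (integrable_norm_pow_mul_gauss k (two_mul_div_five_pos hj)).const_mul _]
  congr 1
  rw [Finset.mul_sum]
  refine Finset.sum_congr rfl fun j hj => ?_
  rw [integral_const_mul, integral_norm_pow_mul_gauss k (two_mul_div_five_pos hj)]
  simp only [div_pow, mul_pow]
  ring

theorem convl_GammaSAW (m n : ℕ) (x : Ed d) :
    convl d (GammaSAW d K m) (GammaSAW d K n) x =
      K * (m : ℝ) ^ (-(d : ℝ) / 2) * (K * (n : ℝ) ^ (-(d : ℝ) / 2)) *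
        ∑ j ∈ Finset.Icc 1 m, ∑ k ∈ Finset.Icc 1 n,
          (j : ℝ) ^ (1 - (d : ℝ) / 2) * (k : ℝ) ^ (1 - (d : ℝ) / 2) *
            gauss d (2 * (j + k : ℕ) / 5) x := by
  have hprod : ∀ y, GammaSAW d K m y * GammaSAW d K n (x - y) =
      K * (m : ℝ) ^ (-(d : ℝ) / 2) * (K * (n : ℝ) ^ (-(d : ℝ) / 2)) *
        ∑ j ∈ Finset.Icc 1 m, ∑ k ∈ Finset.Icc 1 n,
          (j : ℝ) ^ (1 - (d : ℝ) / 2) * (k : ℝ) ^ (1 - (d : ℝ) / 2) *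
            (gauss d (2 * j / 5) y * gauss d (2 * k / 5) (x - y)) := fun y => by
    rw [GammaSAW, GammaSAW, mul_mul_mul_comm, Finset.sum_mul_sum]
    simp only [mul_mul_mul_comm]
  have hint : ∀ j ∈ Finset.Icc 1 m, ∀ k ∈ Finset.Icc 1 n, Integrable fun y =>
      (j : ℝ) ^ (1 - (d : ℝ) / 2) * (k : ℝ) ^ (1 - (d : ℝ) / 2) *
        (gauss d (2 * j / 5) y * gauss d (2 * k / 5) (x - y)) := fun j hj k hk =>
    (integrable_gauss_mul_gauss_sub (two_mul_div_five_pos hj) (two_mul_div_five_pos hk) x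
      ).const_mul _
  simp only [convl, hprod, integral_const_mul]
  rw [integral_finsetSum _ fun j hj => integrable_finsetSum _ (hint j hj)]
  congr 1
  refine Finset.sum_congr rfl fun j hj => ?_
  rw [integral_finsetSum _ (hint j hj)]
  refine Finset.sum_congr rfl fun k hk => ?_
  have := convl_gauss (two_mul_div_five_pos hj) (two_mul_div_five_pos hk) x
  rw [convl] at this
  rw [integral_const_mul, this]
  congr 2
  push_cast
  ring

/-- The constant in the convolution bound for `GammaSAW`. -/
def convConst (d : ℕ) : ℝ :=
  2 ^ (-(1 - (d : ℝ) / 2)) * (2 * ∑' k : ℕ, (k : ℝ) ^ (1 - (d : ℝ) / 2))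

theorem convConst_pos (hd : 5 ≤ d) : 0 < convConst d := by
  have := tsum_rpow_pos (one_sub_half_lt hd)
  unfold convConst
  positivity

theorem convl_GammaSAW_le (hd : 5 ≤ d) (hK : 0 < K) {m n : ℕ} (hm : 1 ≤ m) (hn : 1 ≤ n)
    (x : Ed d) :
    convl d (GammaSAW d K m) (GammaSAW d K n) x ≤
      convConst d * K * ((↑(m + n) : ℝ) / ((m : ℝ) * (n : ℝ))) ^ ((d : ℝ) / 2) *
        GammaSAW d K (m + n) x := by
  have hm' : (0 : ℝ) < m := by exact_mod_cast hm
  have hn' : (0 : ℝ) < n := by exact_mod_cast hn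
  have hmn : (0 : ℝ) < (m + n : ℕ) := by exact_mod_cast (by omega : 0 < m + n)
  have h := sum_sum_rpow_mul_le (one_sub_half_lt hd)
    (f := fun l => gauss d (2 * l / 5) x) (fun l => by unfold gauss; positivity) m n
  rw [convl_GammaSAW]
  refine (mul_le_mul_of_nonneg_left h (by positivity)).trans (le_of_eq ?_)
  rw [GammaSAW, convConst, Real.div_rpow hmn.le (by positivity), Real.mul_rpow hm'.le hn'.le,
    neg_div, Real.rpow_neg hm'.le, Real.rpow_neg hn'.le, Real.rpow_neg hmn.le]
  have h1 : 0 < (m : ℝ) ^ ((d : ℝ) / 2) := by positivity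
  have h2 : 0 < (n : ℝ) ^ ((d : ℝ) / 2) := by positivity
  have h3 : 0 < ((m + n : ℕ) : ℝ) ^ ((d : ℝ) / 2) := by positivity
  field_simp

theorem chiSAW_symm (LK : ℝ) {n s : ℕ} (hs : s ≤ n) : chiSAW d LK n s = chiSAW d LK n (n - s) := by
  rw [chiSAW, chiSAW, Nat.sub_sub_self hs, mul_comm (s : ℝ)]

theorem chiSAW_pos {LK : ℝ} (hL : 0 < LK) {n s : ℕ} (hs : 1 ≤ s) (hsn : s < n) :
    0 < chiSAW d LK n s := by
  have h1 : (0 : ℝ) < s := by exact_mod_cast hs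
  have h2 : (0 : ℝ) < (n - s : ℕ) := by exact_mod_cast (by omega : 0 < n - s)
  have h3 : (0 : ℝ) < n := by exact_mod_cast (by omega : 0 < n)
  unfold chiSAW
  positivity

theorem sum_min_mul_chiSAW_le (hd : 5 ≤ d) {LK : ℝ} (hL : 0 < LK) (n : ℕ) :
    ∑ s ∈ Finset.Ico 1 n, (↑(min s (n - s)) : ℝ) * chiSAW d LK n s ≤
      LK * 2 ^ ((d : ℝ) / 2) * (2 * ∑' k : ℕ, (k : ℝ) ^ (1 - (d : ℝ) / 2)) := by
  set p : ℝ := 1 - (d : ℝ) / 2 with hp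
  have hterm : ∀ s ∈ Finset.Ico 1 n, (↑(min s (n - s)) : ℝ) * chiSAW d LK n s ≤
      LK * 2 ^ ((d : ℝ) / 2) * ((s : ℝ) ^ p + ((n - s : ℕ) : ℝ) ^ p) := fun s hs => by
    obtain ⟨h1, h2⟩ := Finset.mem_Ico.1 hs
    have ha : (0 : ℝ) < s := by exact_mod_cast h1
    have hb : (0 : ℝ) < (n - s : ℕ) := by exact_mod_cast (by omega : 0 < n - s)
    have hn : (n : ℝ) = s + (n - s : ℕ) := by exact_mod_cast (by omega : n = s + (n - s))
    have hmin : (0 : ℝ) < min (s : ℝ) (n - s : ℕ) := lt_min ha hb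
    have h := div_mul_rpow_le (q := (d : ℝ) / 2) (by positivity) ha hb
    rw [← hn] at h
    rw [chiSAW, Nat.cast_min]
    calc _ ≤ min (s : ℝ) (n - s : ℕ) * (LK * (2 ^ ((d : ℝ) / 2) *
          min (s : ℝ) (n - s : ℕ) ^ (-((d : ℝ) / 2)))) := by gcongr
      _ = LK * 2 ^ ((d : ℝ) / 2) * min (s : ℝ) (n - s : ℕ) ^ p := by
        rw [hp, sub_eq_add_neg, Real.rpow_add hmin, Real.rpow_one]
        ring
      _ ≤ _ := by
        gcongr
        exact min_rpow_le_add ha hb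
  have hZ : ∀ g : ℕ → ℕ, Set.InjOn g (Finset.Ico 1 n) →
      ∑ s ∈ Finset.Ico 1 n, ((g s : ℕ) : ℝ) ^ p ≤ ∑' k : ℕ, (k : ℝ) ^ p := fun g hg => by
    rw [← Finset.sum_image (f := fun k : ℕ => (k : ℝ) ^ p) hg]
    exact (Real.summable_nat_rpow.2 (one_sub_half_lt hd)).sum_le_tsum _ fun _ _ => by positivity
  refine (Finset.sum_le_sum hterm).trans ?_
  rw [← Finset.mul_sum, Finset.sum_add_distrib, two_mul (∑' k : ℕ, (k : ℝ) ^ p)]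
  gcongr
  · exact hZ id (Set.injOn_id _)
  · refine hZ (fun s => n - s) fun a ha b hb h => ?_
    simp only [Finset.coe_Ico, Set.mem_Ico] at ha hb h
    omega

theorem GammaSAW_doubling (hK : 0 < K) {t s : ℕ} (ht : 1 ≤ t) (hts : t ≤ s) (hst : s ≤ 2 * t)
    (x : Ed d) : GammaSAW d K s x ≤ 2 ^ ((d : ℝ) / 2) * GammaSAW d K (2 * t) x := by
  have ht' : (0 : ℝ) < t := by exact_mod_cast ht
  have hts' : (t : ℝ) ≤ s := by exact_mod_cast hts
  have hg : ∀ k : ℕ, 0 ≤ (k : ℝ) ^ (1 - (d : ℝ) / 2) * gauss d (2 * k / 5) x := fun k => by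
    unfold gauss; positivity
  have h1 : (s : ℝ) ^ (-(d : ℝ) / 2) ≤
      2 ^ ((d : ℝ) / 2) * ((2 * t : ℕ) : ℝ) ^ (-(d : ℝ) / 2) := by
    push_cast
    rw [Real.mul_rpow (by norm_num) ht'.le, ← mul_assoc, ← Real.rpow_add (by norm_num)]
    have e : (d : ℝ) / 2 + -(d : ℝ) / 2 = 0 := by ring
    have hd0 : (0 : ℝ) ≤ d := by positivity
    rw [e, Real.rpow_zero, one_mul]
    exact Real.rpow_le_rpow_of_nonpos ht' hts' (by linarith)
  unfold GammaSAW
  calc _ ≤ K * (2 ^ ((d : ℝ) / 2) * ((2 * t : ℕ) : ℝ) ^ (-(d : ℝ) / 2)) *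
        ∑ k ∈ Finset.Icc 1 (2 * t), (k : ℝ) ^ (1 - (d : ℝ) / 2) * gauss d (2 * k / 5) x := by
        refine mul_le_mul (mul_le_mul_of_nonneg_left h1 hK.le)
          (Finset.sum_le_sum_of_subset_of_nonneg (Finset.Icc_subset_Icc_right hst)
            fun k _ _ => hg k) (Finset.sum_nonneg fun k _ => hg k) (by positivity)
    _ = _ := by ring

/-- The constant in the smoothing bound for the `2k`-th moment of `GammaSAW`. -/
def smoothConst (d k : ℕ) : ℝ :=
  (2 / 5) ^ (-(d : ℝ) / 2) * ((4 / 3) ^ k * k.factorial) * 2 ^ ((d : ℝ) / 2) /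
    ((2 / 5) ^ k * gaussMoment d k)

theorem smoothConst_pos (hd : d ≠ 0) (k : ℕ) : 0 < smoothConst d k := by
  have := gaussMoment_pos hd k
  unfold smoothConst
  positivity

theorem integral_gauss_sub_mul_norm_pow_mul_gauss_le (k : ℕ) {s t : ℝ} (hs : 0 < s) (ht : 0 < t)
    (x : Ed d) :
    Integrable (fun y => gauss d t (x - y) * (‖y‖ ^ (2 * k) * gauss d (2 * s / 5) y)) ∧
    ∫ y, gauss d t (x - y) * (‖y‖ ^ (2 * k) * gauss d (2 * s / 5) y) ≤
      (2 / 5) ^ (-(d : ℝ) / 2) * ((4 / 3) ^ k * k.factorial) * s ^ k * gauss d (s + t) x := by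
  set C : ℝ := (2 / 5) ^ (-(d : ℝ) / 2) * ((4 / 3) ^ k * k.factorial) * s ^ k
  have hle : ∀ y, gauss d t (x - y) * (‖y‖ ^ (2 * k) * gauss d (2 * s / 5) y) ≤
      C * (gauss d s y * gauss d t (x - y)) := fun y => by
    have := mul_le_mul_of_nonneg_left (norm_pow_mul_gauss_le k hs y) (gauss_pos ht (x - y)).le
    exact this.trans (le_of_eq (by ring))
  have h0 : ∀ y, 0 ≤ gauss d t (x - y) * (‖y‖ ^ (2 * k) * gauss d (2 * s / 5) y) := fun y =>
    mul_nonneg (gauss_pos ht _).le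
      (mul_nonneg (by positivity) (gauss_pos (by positivity) y).le)
  have hI := (integrable_gauss_mul_gauss_sub hs ht x).const_mul C
  have hint : Integrable
      (fun y => gauss d t (x - y) * (‖y‖ ^ (2 * k) * gauss d (2 * s / 5) y)) := by
    refine hI.mono' ?_ (Eventually.of_forall fun y => ?_)
    · have h1 := continuous_gauss (d := d) t
      have h2 := continuous_gauss (d := d) (2 * s / 5)
      exact Continuous.aestronglyMeasurable (by fun_prop)
    · rw [Real.norm_of_nonneg (h0 y)]
      exact hle y
  refine ⟨hint, (integral_mono hint hI hle).trans (le_of_eq ?_)⟩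
  have := convl_gauss hs ht x
  rw [convl] at this
  rw [integral_const_mul, this]

theorem GammaSAW_smoothing (hd : d ≠ 0) (hK : 0 < K) {m : ℕ} {t : ℝ} (hm : 1 ≤ m)
    (hmt : (m : ℝ) ≤ t) (k : ℕ) (x : Ed d) :
    (∫ y, gauss d t (x - y) * (‖y‖ ^ (2 * k) * GammaSAW d K m y)) ≤
      smoothConst d k * gammaMom (GammaSAW d K) k m * gauss d (t + (m : ℝ)) x := by
  have hm' : (0 : ℝ) < m := by exact_mod_cast hm
  have ht : 0 < t := hm'.trans_le hmt
  have hM := gaussMoment_pos hd k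
  set C : ℝ := (2 / 5) ^ (-(d : ℝ) / 2) * ((4 / 3) ^ k * k.factorial) with hC
  have hj0 : ∀ j ∈ Finset.Icc 1 m, (0 : ℝ) < j := fun j hj => by
    exact_mod_cast (Finset.mem_Icc.1 hj).1
  have hexp : ∀ y, gauss d t (x - y) * (‖y‖ ^ (2 * k) * GammaSAW d K m y) =
      K * (m : ℝ) ^ (-(d : ℝ) / 2) * ∑ j ∈ Finset.Icc 1 m, (j : ℝ) ^ (1 - (d : ℝ) / 2) *
        (gauss d t (x - y) * (‖y‖ ^ (2 * k) * gauss d (2 * j / 5) y)) := fun y => by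
    rw [norm_pow_mul_GammaSAW, mul_left_comm, Finset.mul_sum]
    simp only [mul_left_comm (gauss d t (x - y))]
  simp only [hexp, integral_const_mul]
  rw [integral_finsetSum _ fun j hj =>
    (integral_gauss_sub_mul_norm_pow_mul_gauss_le k (hj0 j hj) ht x).1.const_mul _]
  have hsum : ∑ j ∈ Finset.Icc 1 m, ∫ y, (j : ℝ) ^ (1 - (d : ℝ) / 2) *
        (gauss d t (x - y) * (‖y‖ ^ (2 * k) * gauss d (2 * j / 5) y)) ≤
      C * 2 ^ ((d : ℝ) / 2) * gauss d (t + m) x *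
        ∑ j ∈ Finset.Icc 1 m, (j : ℝ) ^ (1 - (d : ℝ) / 2) * (j : ℝ) ^ k := by
    rw [Finset.mul_sum]
    refine Finset.sum_le_sum fun j hj => ?_
    have hjp := hj0 j hj
    have hjm : (j : ℝ) ≤ m := by exact_mod_cast (Finset.mem_Icc.1 hj).2
    rw [integral_const_mul]
    have h1 := (integral_gauss_sub_mul_norm_pow_mul_gauss_le k hjp ht x).2
    have h2 := gauss_le_of_le (s := j + t) (t := t + m) (by positivity) (by linarith)
      (by linarith) x
    calc _ ≤ (j : ℝ) ^ (1 - (d : ℝ) / 2) * (C * (j : ℝ) ^ k *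
          (2 ^ ((d : ℝ) / 2) * gauss d (t + m) x)) := by
          refine mul_le_mul_of_nonneg_left (h1.trans ?_) (by positivity)
          exact mul_le_mul_of_nonneg_left h2 (by positivity)
      _ = _ := by ring
  refine (mul_le_mul_of_nonneg_left hsum (by positivity)).trans (le_of_eq ?_)
  rw [gammaMom_GammaSAW, smoothConst, ← hC]
  field_simp

theorem gammaMom_GammaSAW_nonneg (hK : 0 < K) (k m : ℕ) : 0 ≤ gammaMom (GammaSAW d K) k m :=
  integral_nonneg fun y => by
    refine mul_nonneg (by positivity) ?_
    unfold GammaSAW gauss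
    positivity

theorem gammaMom_GammaSAW_le (hd : 5 ≤ d) (hK : 0 < K) (k m : ℕ) :
    gammaMom (GammaSAW d K) k m ≤
      K * ((2 / 5) ^ k * gaussMoment d k * ∑' j : ℕ, (j : ℝ) ^ (1 - (d : ℝ) / 2)) *
        ((m : ℝ) ^ k * (m : ℝ) ^ (-(d : ℝ) / 2)) := by
  have hM := gaussMoment_pos (d := d) (by omega) k
  rw [gammaMom_GammaSAW]
  have hsum : ∑ j ∈ Finset.Icc 1 m, (j : ℝ) ^ (1 - (d : ℝ) / 2) * (j : ℝ) ^ k ≤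
      (∑' j : ℕ, (j : ℝ) ^ (1 - (d : ℝ) / 2)) * (m : ℝ) ^ k := by
    refine le_trans ?_ (mul_le_mul_of_nonneg_right
      (sum_Icc_rpow_le_tsum (one_sub_half_lt hd) m) (by positivity))
    rw [Finset.sum_mul]
    refine Finset.sum_le_sum fun j hj => ?_
    have : (j : ℝ) ≤ m := by exact_mod_cast (Finset.mem_Icc.1 hj).2
    gcongr
  calc _ ≤ K * (m : ℝ) ^ (-(d : ℝ) / 2) * ((2 / 5) ^ k * gaussMoment d k *
        ((∑' j : ℕ, (j : ℝ) ^ (1 - (d : ℝ) / 2)) * (m : ℝ) ^ k)) := by gcongr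
    _ = _ := by ring

theorem summable_mul_gammaMom_GammaSAW (hd : 5 ≤ d) (hK : 0 < K) (k : ℕ) {w : ℕ → ℝ}
    (hw0 : ∀ n, 0 ≤ w n) (hw : ∀ n : ℕ, 1 ≤ n → w n * (n : ℝ) ^ k = n) :
    Summable fun n : ℕ => w n * gammaMom (GammaSAW d K) k n := by
  set C := K * ((2 / 5) ^ k * gaussMoment d k * ∑' j : ℕ, (j : ℝ) ^ (1 - (d : ℝ) / 2))
  refine Summable.of_nonneg_of_le
    (fun n => mul_nonneg (hw0 n) (gammaMom_GammaSAW_nonneg hK k n)) (fun n => ?_)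
    ((Real.summable_nat_rpow.2 (one_sub_half_lt hd)).mul_left C)
  rcases Nat.eq_zero_or_pos n with rfl | hn
  · have hp := one_sub_half_lt hd
    have h0 : gammaMom (GammaSAW d K) k 0 = 0 := by simp [gammaMom_GammaSAW]
    rw [h0, Nat.cast_zero, Real.zero_rpow (by linarith)]
    simp
  · have hn' : (0 : ℝ) < n := by exact_mod_cast hn
    have hle : gammaMom (GammaSAW d K) k n ≤ C * ((n : ℝ) ^ k * (n : ℝ) ^ (-(d : ℝ) / 2)) :=
      gammaMom_GammaSAW_le hd hK k n
    refine (mul_le_mul_of_nonneg_left hle (hw0 n)).trans (le_of_eq ?_)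
    rw [sub_eq_add_neg, Real.rpow_add hn', Real.rpow_one, neg_div]
    calc _ = C * ((w n * (n : ℝ) ^ k) * (n : ℝ) ^ (-((d : ℝ) / 2))) := by ring
      _ = _ := by rw [hw n hn]

end GammaSAWFacts

/-- The sequence `Γ_n = K n^{-d/2} Σ_{k≤n} k^{1-d/2} φ_{2k/5}` satisfies B1–B4. -/
theorem GammaSAW_satisfies_CondB (d : ℕ) (hd : 5 ≤ d) (K : ℝ) (hK : 0 < K) :
    (∃ χ : ℕ → ℕ → ℝ, ∃ K1 K2 K3 : ℝ, CondB d (GammaSAW d K) χ K1 K2 K3) ∧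
    (∃ L > (0 : ℝ),
      (∀ m n : ℕ, 1 ≤ m → 1 ≤ n → ∀ x : Ed d,
        convl d (GammaSAW d K m) (GammaSAW d K n) x ≤
          L * K * ((↑(m + n) : ℝ) / ((m : ℝ) * (n : ℝ))) ^ ((d : ℝ) / 2) *
            GammaSAW d K (m + n) x) ∧
      (∀ n s : ℕ, 1 ≤ s → s ≤ n → chiSAW d (L * K) n s = chiSAW d (L * K) n (n - s)) ∧
      ∃ K1 : ℝ, ∀ n : ℕ,
        (∑ s ∈ Finset.Ico 1 n, (↑(min s (n - s)) : ℝ) * chiSAW d (L * K) n s) ≤ K1) ∧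
    (∃ K2 : ℝ, ∀ t s : ℕ, 1 ≤ t → t ≤ s → s ≤ 2 * t → ∀ x : Ed d,
      GammaSAW d K s x ≤ K2 * GammaSAW d K (2 * t) x) ∧
    (∃ L > (0 : ℝ), ∀ (m : ℕ) (t : ℝ), 1 ≤ m → (m : ℝ) ≤ t → ∀ k, k ≤ 2 → ∀ x : Ed d,
      (∫ y, gauss d t (x - y) * (‖y‖ ^ (2 * k) * GammaSAW d K m y)) ≤
        L * gammaMom (GammaSAW d K) k m * gauss d (t + (m : ℝ)) x) ∧
    (Summable fun n : ℕ => (n : ℝ) * gammaMom (GammaSAW d K) 0 n) ∧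
    (Summable fun n : ℕ => gammaMom (GammaSAW d K) 1 n) ∧
    (Summable fun n : ℕ => gammaMom (GammaSAW d K) 2 n / (n : ℝ)) := by
  have hd0 : d ≠ 0 := by omega
  have hLK : 0 < convConst d * K := mul_pos (convConst_pos hd) hK
  have hsmooth : ∃ L > (0 : ℝ), ∀ (m : ℕ) (t : ℝ), 1 ≤ m → (m : ℝ) ≤ t → ∀ k, k ≤ 2 →
      ∀ x : Ed d, (∫ y, gauss d t (x - y) * (‖y‖ ^ (2 * k) * GammaSAW d K m y)) ≤
        L * gammaMom (GammaSAW d K) k m * gauss d (t + (m : ℝ)) x := by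
    refine ⟨∑ k ∈ Finset.range 3, smoothConst d k,
      Finset.sum_pos (fun k _ => smoothConst_pos hd0 k) ⟨0, by simp⟩,
      fun m t hm hmt k hk x => (GammaSAW_smoothing hd0 hK hm hmt k x).trans ?_⟩
    have hm' : (0 : ℝ) < m := by exact_mod_cast hm
    have hg := (gauss_pos (d := d) (t := t + m) (by linarith) x).le
    have hγ := gammaMom_GammaSAW_nonneg (d := d) hK k m
    gcongr
    exact Finset.single_le_sum (f := smoothConst d) (fun k _ => (smoothConst_pos hd0 k).le)
      (Finset.mem_range.2 (by omega))
  have hs0 : Summable fun n : ℕ => (n : ℝ) * gammaMom (GammaSAW d K) 0 n :=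
    summable_mul_gammaMom_GammaSAW hd hK 0 (fun n => by positivity) (fun n _ => by simp)
  have hs1 : Summable fun n : ℕ => gammaMom (GammaSAW d K) 1 n := by
    simpa using summable_mul_gammaMom_GammaSAW hd hK 1 (w := fun _ => 1)
      (fun n => by positivity) (fun n _ => by simp)
  have hs2 : Summable fun n : ℕ => gammaMom (GammaSAW d K) 2 n / (n : ℝ) := by
    simpa only [div_eq_inv_mul] using summable_mul_gammaMom_GammaSAW hd hK 2
      (w := fun n => (n : ℝ)⁻¹) (fun n => by positivity) fun n hn => by
        have hn' : (0 : ℝ) < n := by exact_mod_cast hn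
        field_simp
  refine ⟨?_, ⟨convConst d, convConst_pos hd,
    fun m n hm hn x => convl_GammaSAW_le hd hK hm hn x, fun n s _ h => chiSAW_symm _ h,
    _, sum_min_mul_chiSAW_le hd hLK⟩,
    ⟨_, fun t s ht hts hst x => GammaSAW_doubling hK ht hts hst x⟩, hsmooth, hs0, hs1, hs2⟩
  obtain ⟨L, -, hL⟩ := hsmooth
  -- `chiSAW` vanishes at the endpoints, where any symmetric positive value will do.
  refine ⟨fun n s => if s = 0 ∨ n ≤ s then 1 else chiSAW d (convConst d * K) n s, _, _, L,
    { pos := fun m hm x => GammaSAW_pos hK hm x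
      cont := fun m _ => continuous_GammaSAW m
      radial := fun m _ => radial_GammaSAW m
      vanish := fun m _ => vanishAtInfty_GammaSAW m
      integrable := fun m _ k _ => integrable_norm_pow_mul_GammaSAW k m
      chi_pos := fun n s hs _ => ?_
      chi_symm := fun n s hs hsn => ?_
      chi_sum := fun n => (le_of_eq (Finset.sum_congr rfl fun s hs => ?_)).trans
        (sum_min_mul_chiSAW_le hd hLK n)
      conv_le := fun m n hm hn x => ?_
      doubling := fun t s ht hts hst x => GammaSAW_doubling hK ht hts hst x
      smoothing := hL
      sum0 := hs0
      sum1 := hs1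
      sum2 := hs2 }⟩
  · split_ifs with h
    · exact one_pos
    · exact chiSAW_pos hLK hs (by omega)
  · by_cases h : s = n
    · rw [if_pos (by omega), if_pos (by omega)]
    · rw [if_neg (by omega), if_neg (by omega), chiSAW_symm _ hsn]
  · have := Finset.mem_Ico.1 hs
    rw [if_neg (by omega)]
  · rw [if_neg (by omega), chiSAW, Nat.add_sub_cancel_left]
    exact convl_GammaSAW_le hd hK hm hn x
end
end

section
/- For every n ≥ 1 and every x = (x₁,…,x_n) ∈ (ℝ^d)^n (with x₀ = 0): K_{λ,ρ}[0,n](x) = K_{λ,ρ}[1,n](x) + Σ_{m=1}^{n} J[0,m](x) · K_{λ,ρ}[m,n](x). -/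
open MeasureTheory Filter Finset
open scoped Classical

noncomputable section

/-- The edges `st` with `a ≤ s < t ≤ b`. -/
def edgesOn (a b : ℕ) : Finset (ℕ × ℕ) :=
  (Finset.Icc a b ×ˢ Finset.Icc a b).filter fun p => p.1 < p.2

lemma mem_edgesOn {a b : ℕ} {p : ℕ × ℕ} :
    p ∈ edgesOn a b ↔ a ≤ p.1 ∧ p.1 < p.2 ∧ p.2 ≤ b := by
  simp only [edgesOn, Finset.mem_filter, Finset.mem_product, Finset.mem_Icc]
  omega

/-- The connected graphs on `[a,b]`. -/
def connGraphs (a b : ℕ) : Finset (Finset (ℕ × ℕ)) :=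
  ((Finset.Icc a b ×ˢ Finset.Icc a b).powerset).filter (IsConnGraph a b)

lemma mem_connGraphs {a b : ℕ} {G : Finset (ℕ × ℕ)} :
    G ∈ connGraphs a b ↔ IsConnGraph a b G := by
  simp only [connGraphs, Finset.mem_filter, Finset.mem_powerset, and_iff_right_iff_imp]
  intro h p hp
  have := h.1 p hp
  simp only [Finset.mem_product, Finset.mem_Icc]
  omega

/-- The vertex `m` is not strictly below any edge of `G`. -/
def IsCutVertex (G : Finset (ℕ × ℕ)) (m : ℕ) : Prop := ∀ p ∈ G, ¬ (p.1 < m ∧ m < p.2)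

/-- The first positive vertex that is not strictly below any edge of `G`. -/
def firstCut (G : Finset (ℕ × ℕ)) : ℕ := sInf {m | 1 ≤ m ∧ IsCutVertex G m}

lemma firstCut_eq_iff {n m : ℕ} (hn : 1 ≤ n) {G : Finset (ℕ × ℕ)} (hG : G ⊆ edgesOn 0 n) :
    firstCut G = m ↔
      1 ≤ m ∧ IsCutVertex G m ∧ ∀ c, 1 ≤ c → c < m → ∃ p ∈ G, p.1 < c ∧ c < p.2 := by
  have hne : {m | 1 ≤ m ∧ IsCutVertex G m}.Nonempty :=
    ⟨n, hn, fun p hp => by have := mem_edgesOn.1 (hG hp); omega⟩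
  constructor
  · rintro rfl
    refine ⟨(Nat.sInf_mem hne).1, (Nat.sInf_mem hne).2, fun c hc hlt => ?_⟩
    have hmem := Nat.notMem_of_lt_sInf hlt
    simpa [IsCutVertex, hc] using hmem
  · rintro ⟨hm, hcut, hmin⟩
    refine le_antisymm (Nat.sInf_le ⟨hm, hcut⟩) (le_of_not_gt fun hlt => ?_)
    obtain ⟨p, hp, hpc⟩ := hmin _ (Nat.sInf_mem hne).1 hlt
    exact (Nat.sInf_mem hne).2 p hp hpc

lemma firstCut_mem_Icc {n : ℕ} (hn : 1 ≤ n) {G : Finset (ℕ × ℕ)} (hG : G ⊆ edgesOn 0 n) :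
    firstCut G ∈ Finset.Icc 1 n := by
  have hle : firstCut G ≤ n :=
    Nat.sInf_le ⟨hn, fun p hp => by have := mem_edgesOn.1 (hG hp); omega⟩
  exact Finset.mem_Icc.2 ⟨((firstCut_eq_iff hn hG).1 rfl).1, hle⟩

/-- The graphs on `[0,n]` having an edge at `0`. -/
def graphsAtZero (n : ℕ) : Finset (Finset (ℕ × ℕ)) :=
  (edgesOn 0 n).powerset.filter fun G => ∃ p ∈ G, p.1 = 0

lemma isConnGraph_filter_le {n m : ℕ} (hn : 1 ≤ n) {G : Finset (ℕ × ℕ)}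
    (hG : G ∈ graphsAtZero n) (hm : firstCut G = m) :
    IsConnGraph 0 m (G.filter fun p => p.2 ≤ m) := by
  simp only [graphsAtZero, Finset.mem_filter, Finset.mem_powerset] at hG
  obtain ⟨hsub, p, hp, hp0⟩ := hG
  obtain ⟨h1, hcut, hmin⟩ := (firstCut_eq_iff hn hsub).1 hm
  have hp' := mem_edgesOn.1 (hsub hp)
  have hpm := hcut p hp
  refine ⟨fun q hq => ?_, ⟨p, ?_, Or.inl hp0⟩, ?_, fun c hc hcm => ?_⟩
  · rw [Finset.mem_filter] at hq
    have := mem_edgesOn.1 (hsub hq.1)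
    omega
  · exact Finset.mem_filter.2 ⟨hp, by omega⟩
  · obtain rfl | h2 := h1.eq_or_lt
    · exact ⟨p, Finset.mem_filter.2 ⟨hp, by omega⟩, by omega⟩
    · obtain ⟨q, hq, hqc⟩ := hmin (m - 1) (by omega) (by omega)
      have := hcut q hq
      exact ⟨q, Finset.mem_filter.2 ⟨hq, by omega⟩, by omega⟩
  · obtain ⟨q, hq, hqc⟩ := hmin c hc hcm
    have := hcut q hq
    exact ⟨q, Finset.mem_filter.2 ⟨hq, by omega⟩, hqc⟩

lemma union_mem_graphsAtZero {n m : ℕ} (hm : m ≤ n) {G H : Finset (ℕ × ℕ)}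
    (hG : IsConnGraph 0 m G) (hH : H ⊆ edgesOn m n) : G ∪ H ∈ graphsAtZero n := by
  obtain ⟨hsub, ⟨p, hp, hp0⟩, -, -⟩ := hG
  refine Finset.mem_filter.2 ⟨Finset.mem_powerset.2 fun q hq => ?_, p,
    Finset.mem_union_left _ hp, by have := hsub p hp; omega⟩
  rw [mem_edgesOn]
  rcases Finset.mem_union.1 hq with hq | hq
  · have := hsub q hq
    omega
  · have := mem_edgesOn.1 (hH hq)
    omega

lemma firstCut_union {n m : ℕ} (hm1 : 1 ≤ m) (hm : m ≤ n) {G H : Finset (ℕ × ℕ)}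
    (hG : IsConnGraph 0 m G) (hH : H ⊆ edgesOn m n) : firstCut (G ∪ H) = m := by
  have hsub := Finset.mem_powerset.1 (Finset.mem_filter.1 (union_mem_graphsAtZero hm hG hH)).1
  refine (firstCut_eq_iff (hm1.trans hm) hsub).2 ⟨hm1, fun q hq => ?_, fun c hc hcm => ?_⟩
  · rcases Finset.mem_union.1 hq with hq | hq
    · have := hG.1 q hq
      omega
    · have := mem_edgesOn.1 (hH hq)
      omega
  · obtain ⟨q, hq, hqc⟩ := hG.2.2.2 c hc hcm
    exact ⟨q, Finset.mem_union_left _ hq, hqc⟩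

lemma sum_connGraphs_mul_prod_edgesOn {R : Type*} [CommRing R] (f : ℕ × ℕ → R) {n m : ℕ}
    (hm1 : 1 ≤ m) (hm : m ≤ n) :
    (∑ G ∈ connGraphs 0 m, ∏ p ∈ G, f p) * ∏ p ∈ edgesOn m n, (1 + f p) =
      ∑ G ∈ (graphsAtZero n).filter (fun G => firstCut G = m), ∏ p ∈ G, f p := by
  rw [Finset.prod_one_add, Finset.sum_mul_sum, ← Finset.sum_product']
  refine Finset.sum_nbij' (fun x => x.1 ∪ x.2)
    (fun G => (G.filter (fun p => p.2 ≤ m), G.filter (fun p => m ≤ p.1))) ?_ ?_ ?_ ?_ ?_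
  · rintro ⟨G, H⟩ h
    rw [Finset.mem_product, mem_connGraphs, Finset.mem_powerset] at h
    exact Finset.mem_filter.2
      ⟨union_mem_graphsAtZero hm h.1 h.2, firstCut_union hm1 hm h.1 h.2⟩
  · intro G h
    rw [Finset.mem_filter] at h
    refine Finset.mem_product.2 ⟨mem_connGraphs.2
      (isConnGraph_filter_le (hm1.trans hm) h.1 h.2), Finset.mem_powerset.2 fun q hq => ?_⟩
    rw [Finset.mem_filter] at hq
    have := mem_edgesOn.1 (Finset.mem_powerset.1 (Finset.mem_filter.1 h.1).1 hq.1)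
    rw [mem_edgesOn]
    omega
  · rintro ⟨G, H⟩ h
    rw [Finset.mem_product, mem_connGraphs, Finset.mem_powerset] at h
    have hG : ∀ p ∈ G, p.1 < p.2 ∧ p.2 ≤ m := fun p hp => (h.1.1 p hp).2
    have hH : ∀ p ∈ H, m ≤ p.1 ∧ p.1 < p.2 := fun p hp => by
      have := mem_edgesOn.1 (h.2 hp)
      omega
    refine Prod.ext (Finset.ext fun q => ?_) (Finset.ext fun q => ?_) <;>
      have h1 := hG q <;> have h2 := hH q <;>
      simp only [Finset.mem_filter, Finset.mem_union] <;> grind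
  · intro G h
    rw [Finset.mem_filter] at h
    have hsub := Finset.mem_powerset.1 (Finset.mem_filter.1 h.1).1
    have hcut := ((firstCut_eq_iff (hm1.trans hm) hsub).1 h.2).2.1
    ext q
    simp only [Finset.mem_filter, Finset.mem_union, ← and_or_left, and_iff_left_iff_imp]
    intro hq
    have := hcut q hq
    omega
  · rintro ⟨G, H⟩ h
    rw [Finset.mem_product, mem_connGraphs, Finset.mem_powerset] at h
    refine (Finset.prod_union (Finset.disjoint_left.2 fun q hq hq' => ?_)).symm
    have := h.1.1 q hq
    have := mem_edgesOn.1 (h.2 hq')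
    omega

lemma powerset_edgesOn_filter_not_zero (n : ℕ) :
    (edgesOn 0 n).powerset.filter (fun G => ¬ ∃ p ∈ G, p.1 = 0) = (edgesOn 1 n).powerset := by
  ext G
  simp only [Finset.mem_filter, Finset.mem_powerset, Finset.subset_iff, mem_edgesOn]
  constructor
  · rintro ⟨hsub, h0⟩ p hp
    have := hsub hp
    have : p.1 ≠ 0 := fun h => h0 ⟨p, hp, h⟩
    omega
  · intro h
    refine ⟨fun p hp => ?_, ?_⟩
    · have := h hp
      omega
    · rintro ⟨p, hp, hp0⟩
      have := h hp
      omega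

/-- Resummation of the expansion of `∏ (1 + f)` over graphs on `[0,n]` according to the first
vertex that is not strictly below an edge. -/
theorem prod_edgesOn_resummation {R : Type*} [CommRing R] (f : ℕ × ℕ → R) {n : ℕ}
    (hn : 1 ≤ n) :
    ∏ p ∈ edgesOn 0 n, (1 + f p) = ∏ p ∈ edgesOn 1 n, (1 + f p) +
      ∑ m ∈ Finset.Icc 1 n,
        (∑ G ∈ connGraphs 0 m, ∏ p ∈ G, f p) * ∏ p ∈ edgesOn m n, (1 + f p) := by
  have hmaps : ∀ G ∈ graphsAtZero n, firstCut G ∈ Finset.Icc 1 n := fun G hG =>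
    firstCut_mem_Icc hn (Finset.mem_powerset.1 (Finset.mem_filter.1 hG).1)
  rw [Finset.sum_congr rfl fun m hm => sum_connGraphs_mul_prod_edgesOn f
      (Finset.mem_Icc.1 hm).1 (Finset.mem_Icc.1 hm).2,
    Finset.sum_fiberwise_of_maps_to hmaps, Finset.prod_one_add, Finset.prod_one_add,
    ← powerset_edgesOn_filter_not_zero, graphsAtZero, add_comm,
    Finset.sum_filter_add_sum_filter_not]

/-- Pathwise resummation identity `K[0,n] = K[1,n] + Σ_m J[0,m] K[m,n]`. -/
theorem K_resummation (d : ℕ) (lam ρ : ℝ)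
    (hlam0 : 0 ≤ lam) (hlam1 : lam ≤ 1) (hρ : 0 < ρ) (hρ1 : ρ ≤ 1)
    (n : ℕ) (hn : 1 ≤ n) (y : ℕ → Ed d) (h0 : y 0 = 0) :
    Ksaw d lam ρ 0 n y =
      Ksaw d lam ρ 1 n y +
        ∑ m ∈ Finset.Icc 1 n, Jsaw d lam ρ 0 m y * Ksaw d lam ρ m n y := by
  simpa only [Ksaw, Jsaw, edgesOn, connGraphs, ← sub_eq_add_neg] using
    prod_edgesOn_resummation (fun p => -(lam * indBall d ρ (y p.2 - y p.1))) hn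
end
end
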